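/- Semantic Craig interpolation for propositional logic. Let V be a type of propositional variables, let A and B be sets of variables, and let f and g be predicates on valuations such that f depends only on A, g depends only on B, and their conjunction is unsatisfiable, i.e., there is no valuation v with both f v and g v. Then there exists a predicate I on valuations (an interpolant) that depends only on A ∩ B, such that every valuation satisfying f satisfies I, and no valuation satisfies both I and g. -/

import Mathlib

/-- **Semantic Craig interpolation for propositional logic.**  If `f` depends only on
`A`, `g` depends only on `B`, and `f ∧ g` is unsatisfiable, then there is an interpolant
`I` depending only on `A ∩ B` with `f → I` and `I ∧ g` unsatisfiable. -/
theorem semantic_craig_interpolation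
    {V : Type*} (A B : Set V)
    (f g : (V → Bool) → Prop)
    (hf : ∀ v v' : V → Bool, (∀ x ∈ A, v x = v' x) → (f v ↔ f v'))
    (hg : ∀ v v' : V → Bool, (∀ x ∈ B, v x = v' x) → (g v ↔ g v'))
    (hunsat : ∀ v : V → Bool, ¬ (f v ∧ g v)) :
    ∃ I : (V → Bool) → Prop,
      (∀ v v' : V → Bool, (∀ x ∈ A ∩ B, v x = v' x) → (I v ↔ I v')) ∧
      (∀ v, f v → I v) ∧
      (∀ v, ¬ (I v ∧ g v)) := by
  classical
  refine ⟨fun v => ∃ w, f w ∧ ∀ x ∈ A ∩ B, w x = v x, fun v v' h => ?_,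
    fun v hv => ⟨v, hv, fun _ _ => rfl⟩, ?_⟩
  · constructor
    · rintro ⟨w, hw, hwv⟩
      exact ⟨w, hw, fun x hx => (hwv x hx).trans (h x hx)⟩
    · rintro ⟨w, hw, hwv⟩
      exact ⟨w, hw, fun x hx => (hwv x hx).trans (h x hx).symm⟩
  · rintro v ⟨⟨w, hw, hwv⟩, hv⟩
    -- Glue `w` on `A` to `v` off `A`.
    refine hunsat (A.piecewise w v) ⟨(hf _ w fun x hx => ?_).mpr hw, (hg _ v fun x hx => ?_).mpr hv⟩
    · exact Set.piecewise_eq_of_mem A w v hx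
    · by_cases hA : x ∈ A
      · exact (Set.piecewise_eq_of_mem A w v hA).trans (hwv x ⟨hA, hx⟩)
      · exact Set.piecewise_eq_of_notMem A w v hA
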